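/- arXiv:0710.0483 — 6 statements merged into one kernel-verified Lean document; each statement's English description precedes it below -/
import Mathlib

section
/- Let I ⊆ ℝ be an open interval and let γ : I → Herm(2) be a smooth curve such that for every t ∈ I: (i) γ(t) is Hermitian with det γ(t) = −1 (so γ takes values in de Sitter 3-space S³₁); (ii) γ is null, i.e. det γ'(t) = 0; (iii) γ has no flex points, i.e. the three matrices γ(t), γ'(t), γ''(t) are linearly independent over ℝ in Herm(2). Then there exist ε ∈ {1, −1}, a smooth map Γ : I → M₂(ℂ) with det Γ(t) = 1 for all t, a smooth nowhere-vanishing function ω : I → ℝ, and a smooth function k : I → ℝ, such that γ(t) = Γ(t) · J · Γ(t)* and Γ'(t) = ω(t) • (Γ(t) · [[0, ε],[k(t) + i, 0]]) for all t ∈ I (the canonical frame, canonical pseudo-arc element, and curvature of γ). -/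
open Matrix Complex

noncomputable section

/-- 2×2 complex matrices. -/
abbrev M2 : Type := Matrix (Fin 2) (Fin 2) ℂ

/-- The Hermitian matrix `J = [[0, -i],[i, 0]]`. -/
def Jmat : M2 := !![0, -Complex.I; Complex.I, 0]

/-- Entrywise derivative of a matrix-valued function. -/
def Mderiv (γ : ℝ → M2) : ℝ → M2 :=
  fun t => Matrix.of fun i j => deriv (fun s => γ s i j) t

/-- Entrywise smoothness of a matrix-valued function on a set. -/
def MSmoothOn (γ : ℝ → M2) (S : Set ℝ) : Prop :=
  ∀ i j, ContDiffOn ℝ (⊤ : ℕ∞) (fun s => γ s i j) S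

/-- The matrix `H_ε(k) = [[0, ε],[k + i, 0]]` of the canonical frame equation. -/
def Hmat (ε k : ℝ) : M2 := !![0, (ε : ℂ); (k : ℂ) + Complex.I, 0]

/-- The existence of a canonical frame along `γ` over the interval `(a, b)`. -/
def HasCanonicalFrame (a b : ℝ) (γ : ℝ → M2) : Prop :=
  ∃ (ε : ℝ) (Γ : ℝ → M2) (ω k : ℝ → ℝ),
      (ε = 1 ∨ ε = -1) ∧
      MSmoothOn Γ (Set.Ioo a b) ∧
      ContDiffOn ℝ (⊤ : ℕ∞) ω (Set.Ioo a b) ∧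
      (∀ t ∈ Set.Ioo a b, ω t ≠ 0) ∧
      ContDiffOn ℝ (⊤ : ℕ∞) k (Set.Ioo a b) ∧
      (∀ t ∈ Set.Ioo a b, (Γ t).det = 1) ∧
      (∀ t ∈ Set.Ioo a b, γ t = Γ t * Jmat * (Γ t)ᴴ) ∧
      (∀ t ∈ Set.Ioo a b, Mderiv Γ t = ω t • (Γ t * Hmat ε (k t)))

section

open scoped ContDiff ComplexConjugate

theorem exists_contDiffOn_primitive {a b : ℝ} {f : ℝ → ℝ}
    (hf : ContDiffOn ℝ ∞ f (Set.Ioo a b)) :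
    ∃ F : ℝ → ℝ, ContDiffOn ℝ ∞ F (Set.Ioo a b) ∧
      ∀ t ∈ Set.Ioo a b, HasDerivAt F (f t) t := by
  rcases (Set.Ioo a b).eq_empty_or_nonempty with h | ⟨c, hc⟩
  · exact ⟨f, hf, by simp [h]⟩
  have hd : ∀ t ∈ Set.Ioo a b, HasDerivAt (fun u => ∫ x in c..u, f x) (f t) t := by
    intro t ht
    have hsub : Set.uIcc c t ⊆ Set.Ioo a b := Set.OrdConnected.uIcc_subset inferInstance hc ht
    exact intervalIntegral.integral_hasDerivAt_right
      (hf.continuousOn.mono hsub).intervalIntegrable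
      (hf.continuousOn.stronglyMeasurableAtFilter isOpen_Ioo t ht)
      (hf.continuousOn.continuousAt (isOpen_Ioo.mem_nhds ht))
  refine ⟨_, ?_, hd⟩
  rw [contDiffOn_infty_iff_deriv_of_isOpen isOpen_Ioo]
  exact ⟨fun t ht => (hd t ht).differentiableAt.differentiableWithinAt,
    hf.congr fun t ht => (hd t ht).deriv⟩

/-- A differentiable curve in the complex plane is not surjective. -/
theorem exists_notMem_image_of_differentiableAt {f : ℝ → ℂ} {S : Set ℝ}
    (hf : ∀ t ∈ S, DifferentiableAt ℝ f t) : ∃ ζ : ℂ, ζ ∉ f '' S := by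
  let s : Set ℂ := {z | z.re ∈ S ∧ z.im = 0}
  have hs : MeasureTheory.volume s = 0 := by
    have hker : MeasureTheory.volume ((LinearMap.ker Complex.imLm : Submodule ℝ ℂ) : Set ℂ) = 0 := by
      apply MeasureTheory.Measure.addHaar_submodule
      intro h
      have : Complex.I ∈ LinearMap.ker Complex.imLm := h ▸ Submodule.mem_top
      simp at this
    exact MeasureTheory.measure_mono_null (fun z hz => by simpa using hz.2) hker
  have hd : DifferentiableOn ℝ (fun z : ℂ => f z.re) s := fun z hz =>
    ((hf z.re hz.1).comp z Complex.reCLM.differentiableAt).differentiableWithinAt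
  have him := MeasureTheory.addHaar_image_eq_zero_of_differentiableOn_of_addHaar_eq_zero
    MeasureTheory.volume hd hs
  by_contra! hall
  have huniv : (fun z : ℂ => f z.re) '' s = Set.univ := by
    refine Set.eq_univ_of_forall fun ζ => ?_
    obtain ⟨t, ht, rfl⟩ := hall ζ
    exact ⟨(t : ℂ), ⟨by simpa using ht, by simp⟩, by simp⟩
  rw [huniv] at him
  exact NeZero.ne _ him

theorem exists_sign_mul_pos {a b : ℝ} {f : ℝ → ℝ} (hf : ContinuousOn f (Set.Ioo a b))
    (hne : ∀ t ∈ Set.Ioo a b, f t ≠ 0) :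
    ∃ ε : ℝ, (ε = 1 ∨ ε = -1) ∧ ∀ t ∈ Set.Ioo a b, 0 < ε * f t := by
  by_cases h : ∃ t ∈ Set.Ioo a b, f t < 0
  · obtain ⟨t, ht, hlt⟩ := h
    refine ⟨-1, Or.inr rfl, fun s hs => ?_⟩
    by_contra! hle
    obtain ⟨u, hu, hu0⟩ := isPreconnected_Ioo.intermediate_value ht hs hf
      (show (0 : ℝ) ∈ Set.Icc (f t) (f s) from ⟨hlt.le, by linarith⟩)
    exact hne u hu hu0
  · push Not at h
    exact ⟨1, Or.inl rfl, fun s hs => by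
      simpa using lt_of_le_of_ne (h s hs) (hne s hs).symm⟩

theorem ContDiffOn.ofReal {f : ℝ → ℝ} {S : Set ℝ} (hf : ContDiffOn ℝ ∞ f S) :
    ContDiffOn ℝ ∞ (fun t => (f t : ℂ)) S :=
  Complex.ofRealCLM.contDiff.comp_contDiffOn hf

theorem ContDiffOn.hasDerivAt_Ioo {E : Type*} [NormedAddCommGroup E] [NormedSpace ℝ E]
    {f : ℝ → E} {a b t : ℝ} (hf : ContDiffOn ℝ ∞ f (Set.Ioo a b)) (ht : t ∈ Set.Ioo a b) :
    HasDerivAt f (deriv f t) t :=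
  ((hf.differentiableOn (by simp) t ht).differentiableAt (isOpen_Ioo.mem_nhds ht)).hasDerivAt

/-- A smooth square root of `I * E / c`, where `c` is a unit complex function rotating with angular
speed `-2 * θ` and `E = exp (2 * σ)`. -/
theorem exists_smooth_spinor {a b : ℝ} {σ θ : ℝ → ℝ} {c : ℝ → ℂ}
    (hσ : ContDiffOn ℝ ∞ σ (Set.Ioo a b)) (hθ : ContDiffOn ℝ ∞ θ (Set.Ioo a b))
    (hc' : ∀ t ∈ Set.Ioo a b, HasDerivAt c (-2 * Complex.I * θ t * c t) t)
    (hc1 : ∀ t ∈ Set.Ioo a b, c t * conj (c t) = 1) :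
    ∃ g : ℝ → ℂ, ContDiffOn ℝ ∞ g (Set.Ioo a b) ∧
      (∀ t ∈ Set.Ioo a b, HasDerivAt g (g t * (deriv σ t + Complex.I * θ t)) t) ∧
      (∀ t ∈ Set.Ioo a b, g t ^ 2 * c t = Complex.I * Real.exp (2 * σ t)) ∧
      (∀ t ∈ Set.Ioo a b, g t * conj (g t) = Real.exp (2 * σ t)) := by
  rcases (Set.Ioo a b).eq_empty_or_nonempty with h | ⟨t₀, ht₀⟩
  · exact ⟨fun _ => 0, by simp [h], by simp [h], by simp [h], by simp [h]⟩
  obtain ⟨Θ, hΘ, hΘ'⟩ := exists_contDiffOn_primitive hθ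
  have hcst : ∀ t ∈ Set.Ioo a b, HasDerivAt
      (fun s => c s * Complex.exp (2 * (Complex.I * Θ s))) 0 t := by
    intro t ht
    convert! (hc' t ht).mul
      ((((hΘ' t ht).ofReal_comp).const_mul Complex.I).const_mul 2).cexp using 1
    ring
  obtain ⟨d, hd⟩ := isOpen_Ioo.exists_is_const_of_deriv_eq_zero isPreconnected_Ioo
    (fun t ht => (hcst t ht).differentiableAt.differentiableWithinAt)
    (fun t ht => (hcst t ht).deriv)
  have hcn : ∀ t ∈ Set.Ioo a b, ‖c t‖ = 1 := by
    intro t ht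
    have := hc1 t ht
    rw [Complex.mul_conj, Complex.normSq_eq_norm_sq] at this
    have h2 : ‖c t‖ ^ 2 = 1 := by exact_mod_cast this
    exact (pow_eq_one_iff_of_nonneg (norm_nonneg _) two_ne_zero).1 h2
  have hexp : ∀ r : ℝ, ‖Complex.exp (2 * (Complex.I * r))‖ = 1 := by
    intro r
    simp [Complex.norm_exp]
  have hdn : ‖d‖ = 1 := by
    rw [← hd t₀ ht₀, norm_mul, hcn t₀ ht₀, hexp, one_mul]
  have hd0 : d ≠ 0 := by
    intro h
    simp [h] at hdn
  obtain ⟨κ, hκ⟩ := IsAlgClosed.exists_pow_nat_eq (Complex.I / d) (n := 2) (by norm_num)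
  have hκn : ‖κ‖ = 1 := by
    have : ‖κ‖ ^ 2 = 1 := by rw [← norm_pow, hκ]; simp [hdn]
    exact (pow_eq_one_iff_of_nonneg (norm_nonneg _) two_ne_zero).1 this
  refine ⟨fun t => κ * Complex.exp (σ t + Complex.I * Θ t), ?_, ?_, ?_, ?_⟩
  · exact contDiffOn_const.mul ((hσ.ofReal.add (contDiffOn_const.mul hΘ.ofReal)).cexp)
  · intro t ht
    convert! ((((hσ.hasDerivAt_Ioo ht).ofReal_comp).add
      (((hΘ' t ht).ofReal_comp).const_mul Complex.I)).cexp.const_mul κ) using 1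
    simp only [Pi.add_apply]
    ring
  · intro t ht
    have h1 := hd t ht
    have h2 : κ ^ 2 * d = Complex.I := by rw [hκ]; field_simp
    rw [mul_pow, ← Complex.exp_nat_mul]
    have h3 : ((2 : ℕ) : ℂ) * (σ t + Complex.I * Θ t) = (2 * σ t : ℝ) + 2 * (Complex.I * Θ t) := by
      push_cast; ring
    rw [h3, Complex.exp_add, ← Complex.ofReal_exp]
    linear_combination (κ ^ 2 * Real.exp (2 * σ t)) * h1 + Real.exp (2 * σ t) * h2
  · intro t ht
    rw [Complex.mul_conj, Complex.normSq_eq_norm_sq, norm_mul, hκn, Complex.norm_exp]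
    congr 1
    rw [one_mul, sq, ← Real.exp_add]
    congr 1
    simp
    ring

theorem MSmoothOn.hasDerivAt {γ : ℝ → M2} {a b t : ℝ} (hγ : MSmoothOn γ (Set.Ioo a b))
    (ht : t ∈ Set.Ioo a b) (i j : Fin 2) :
    HasDerivAt (fun s => γ s i j) (Mderiv γ t i j) t :=
  (hγ i j).hasDerivAt_Ioo ht

/-- A null curve is written with `x` its upper left entry, `(1, w)` the direction of its tangent
line, and `c` a unit complex number proportional to `w'`. In these terms the frame is explicit up
to the choice of a smooth square root. -/
theorem hasCanonicalFrame_of_coordinates {a b : ℝ} {x A h : ℝ → ℝ} {w c : ℝ → ℂ}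
    (hx : ContDiffOn ℝ ∞ x (Set.Ioo a b)) (hA : ContDiffOn ℝ ∞ A (Set.Ioo a b))
    (hh : ContDiffOn ℝ ∞ h (Set.Ioo a b)) (hw : ContDiffOn ℝ ∞ w (Set.Ioo a b))
    (hc : ContDiffOn ℝ ∞ c (Set.Ioo a b))
    (hA0 : ∀ t ∈ Set.Ioo a b, A t ≠ 0) (hh0 : ∀ t ∈ Set.Ioo a b, h t ≠ 0)
    (hx' : ∀ t ∈ Set.Ioo a b, HasDerivAt x (A t) t)
    (hw' : ∀ t ∈ Set.Ioo a b, HasDerivAt w (I * h t * c t) t)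
    (hc' : ∀ t ∈ Set.Ioo a b, HasDerivAt c (-I * x t * h t * c t) t)
    (hc1 : ∀ t ∈ Set.Ioo a b, c t * conj (c t) = 1)
    {γ : ℝ → M2}
    (hγ : ∀ t ∈ Set.Ioo a b, γ t =
      !![(x t : ℂ), conj (c t + x t * w t); c t + x t * w t,
        conj (c t + x t * w t) * w t + (c t + x t * w t) * conj (w t)
          - x t * (w t * conj (w t))]) :
    HasCanonicalFrame a b γ := by
  obtain ⟨ε, hε, hpos⟩ := exists_sign_mul_pos (hA.div hh hh0).continuousOn
    (fun t ht => div_ne_zero (hA0 t ht) (hh0 t ht))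
  replace hpos : ∀ t ∈ Set.Ioo a b, 0 < ε * (A t / h t) := hpos
  have hε2 : ε * ε = 1 := by rcases hε with rfl | rfl <;> norm_num
  set σ : ℝ → ℝ := fun t => Real.log (ε * (A t / h t) / 2) / 4 with hσdef
  have hσ : ContDiffOn ℝ ∞ σ (Set.Ioo a b) :=
    ((((contDiffOn_const (c := ε)).mul (hA.div hh hh0)).div_const 2).log
      (fun t ht => (half_pos (hpos t ht)).ne')).div_const 4
  set E : ℝ → ℝ := fun t => Real.exp (2 * σ t) with hEdef
  have hE : ContDiffOn ℝ ∞ E (Set.Ioo a b) := (contDiffOn_const.mul hσ).exp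
  have hE0 : ∀ t, E t ≠ 0 := fun t => (Real.exp_pos _).ne'
  have hAE : ∀ t ∈ Set.Ioo a b, A t = 2 * ε * h t * E t ^ 2 := by
    intro t ht
    have : E t ^ 2 = ε * (A t / h t) / 2 := by
      rw [hEdef, sq, ← Real.exp_add, hσdef]
      convert Real.exp_log (half_pos (hpos t ht)) using 2
      simp only
      ring
    have hht := hh0 t ht
    rw [this]
    field_simp
    linear_combination -A t * hε2
  obtain ⟨g, hg, hg', hgc, hgg⟩ := exists_smooth_spinor (θ := fun t => x t * h t / 2) hσ
    ((hx.mul hh).div_const 2)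
    (fun t ht => by convert hc' t ht using 1; push_cast; ring) hc1
  have hEh : ∀ t ∈ Set.Ioo a b, E t * h t ≠ 0 := fun t ht => mul_ne_zero (hE0 t) (hh0 t ht)
  have hσd : ContDiffOn ℝ ∞ (deriv σ) (Set.Ioo a b) := hσ.deriv_of_isOpen isOpen_Ioo (by simp)
  set τ : ℝ → ℝ := fun t => deriv σ t / (E t * h t)
  have hτ : ContDiffOn ℝ ∞ τ (Set.Ioo a b) := hσd.div (hE.mul hh) hEh
  have hτd : ContDiffOn ℝ ∞ (deriv τ) (Set.Ioo a b) := hτ.deriv_of_isOpen isOpen_Ioo (by simp)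
  have hστ : ∀ t ∈ Set.Ioo a b, deriv σ t = τ t * (E t * h t) := fun t ht =>
    (div_mul_cancel₀ _ (hEh t ht)).symm
  have hE' : ∀ t ∈ Set.Ioo a b, HasDerivAt E (2 * τ t * E t ^ 2 * h t) t := by
    intro t ht
    convert! ((hσ.hasDerivAt_Ioo ht).const_mul 2).exp using 1
    rw [hστ t ht, hEdef]
    ring
  set q : ℝ → ℂ := fun t => τ t + I * (x t / (2 * E t) : ℝ) with hqdef
  have hq : ContDiffOn ℝ ∞ q (Set.Ioo a b) :=
    hτ.ofReal.add (contDiffOn_const.mul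
      (hx.div (contDiffOn_const.mul hE) fun t _ => mul_ne_zero two_ne_zero (hE0 t)).ofReal)
  have hq' : ∀ t ∈ Set.Ioo a b,
      HasDerivAt q (deriv τ t + I * (A t / (2 * E t) - x t * τ t * h t : ℝ)) t := by
    intro t ht
    have h2E : 2 * E t ≠ 0 := mul_ne_zero two_ne_zero (hE0 t)
    convert! (hτ.hasDerivAt_Ioo ht).ofReal_comp.add
      ((((hx' t ht).div ((hE' t ht).const_mul 2) h2E).ofReal_comp).const_mul I) using 4
    have := hE0 t
    field_simp
  have hg1 : ∀ t ∈ Set.Ioo a b, HasDerivAt g (g t * (E t * h t * q t)) t := by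
    intro t ht
    convert hg' t ht using 2
    have : (E t : ℂ) ≠ 0 := by exact_mod_cast hE0 t
    rw [hστ t ht, hqdef]
    push_cast
    field_simp
  set k : ℝ → ℝ := fun t =>
    (E t * h t * (τ t ^ 2 - (x t / (2 * E t)) ^ 2) + deriv τ t) / (ε * (E t * h t))
  have hε0 : ε ≠ 0 := by rintro rfl; simp at hε2
  have hω0 : ∀ t ∈ Set.Ioo a b, ε * (E t * h t) ≠ 0 := fun t ht => mul_ne_zero hε0 (hEh t ht)
  have hω : ContDiffOn ℝ ∞ (fun t => ε * (E t * h t)) (Set.Ioo a b) :=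
    contDiffOn_const.mul (hE.mul hh)
  have hk : ContDiffOn ℝ ∞ k (Set.Ioo a b) :=
    (((hE.mul hh).mul ((hτ.pow 2).sub ((hx.div (contDiffOn_const.mul hE) fun t _ =>
      mul_ne_zero two_ne_zero (hE0 t)).pow 2))).add hτd).div hω hω0
  have hn : ∀ t ∈ Set.Ioo a b, (E t * h t * q t ^ 2 +
      (deriv τ t + I * (A t / (2 * E t) - x t * τ t * h t : ℝ)) : ℂ) =
      ((ε * (E t * h t) : ℝ) : ℂ) * (k t + I) := by
    intro t ht
    have h1 : (ε * (E t * h t)) * k t =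
        E t * h t * (τ t ^ 2 - (x t / (2 * E t)) ^ 2) + deriv τ t := mul_div_cancel₀ _ (hω0 t ht)
    have h2 : A t / (2 * E t) = ε * (E t * h t) := by
      have := hE0 t
      rw [hAE t ht]
      field_simp
    have h3 : E t * h t * (2 * τ t * (x t / (2 * E t))) = x t * τ t * h t := by
      have := hE0 t
      field_simp
    have h1' := congrArg Complex.ofReal h1
    have h3' := congrArg Complex.ofReal h3
    rw [h2, hqdef]
    push_cast at h1' h3' ⊢
    linear_combination I * h3' - h1' + (E t * h t * (x t / (2 * E t)) ^ 2 : ℂ) * Complex.I_sq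
  have hΓ' : ∀ t ∈ Set.Ioo a b, ∀ i j, HasDerivAt
      (fun s => (!![g s * q s, g s; g s * (q s * w s + I * c s / E s), g s * w s] : M2) i j)
      ((((ε * (E t * h t) : ℝ) : ℂ) • ((!![g t * q t, g t; g t * (q t * w t + I * c t / E t),
        g t * w t] : M2) * Hmat ε (k t))) i j) t := by
    intro t ht i j
    have hEc : (E t : ℂ) ≠ 0 := by exact_mod_cast hE0 t
    have hεc : (ε : ℂ) * ε = 1 := by exact_mod_cast hε2
    have hqE : 2 * E t * q t = 2 * E t * τ t + I * x t := by
      rw [hqdef]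
      push_cast
      field_simp
    have hnt := hn t ht
    have hu1 := (hg1 t ht).mul (hq' t ht)
    have hv2 := (hg1 t ht).mul (hw' t ht)
    have hu2 := (hg1 t ht).mul (((hq' t ht).mul (hw' t ht)).add
      (((hc' t ht).const_mul I).div ((hE' t ht).ofReal_comp) hEc))
    push_cast at hnt
    fin_cases i <;> fin_cases j
    · convert! hu1 using 1
      simp [Hmat]
      linear_combination -g t * hnt
    · convert! hg1 t ht using 1
      simp [Hmat]
      linear_combination (E t * h t * g t * q t) * hεc
    · convert! hu2 using 1
      simp [Hmat]
      field_simp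
      field_simp at hnt
      linear_combination -(g t * w t) * hnt - 2 * g t * h t * I * c t * hqE
    · convert! hv2 using 1
      simp [Hmat]
      field_simp
      linear_combination (h t * g t * (E t * q t * w t + I * c t)) * hεc
  refine ⟨ε, fun t => !![g t * q t, g t; g t * (q t * w t + I * c t / E t), g t * w t],
    fun t => ε * (E t * h t), k, hε, ?_, hω, hω0, hk, ?_, ?_, ?_⟩
  · have hu2 : ContDiffOn ℝ ∞ (fun t => g t * (q t * w t + I * c t / E t)) (Set.Ioo a b) := by
      simp only [div_eq_mul_inv]
      exact hg.mul ((hq.mul hw).add ((contDiffOn_const.mul hc).mul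
        (hE.ofReal.inv fun t _ => by exact_mod_cast hE0 t)))
    intro i j
    fin_cases i <;> fin_cases j
    · exact hg.mul hq
    · exact hg
    · exact hu2
    · exact hg.mul hw
  · intro t ht
    have hEc : (E t : ℂ) ≠ 0 := by exact_mod_cast hE0 t
    have h1 : g t ^ 2 * c t = I * E t := hgc t ht
    rw [Matrix.det_fin_two_of]
    field_simp
    linear_combination -I * h1 - E t * Complex.I_sq
  · intro t ht
    have hEc : (E t : ℂ) ≠ 0 := by exact_mod_cast hE0 t
    have h1 : g t * conj (g t) = E t := hgg t ht
    rw [hγ t ht]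
    ext i j
    have h2 : conj (2 : ℂ) = 2 := map_ofNat _ 2
    fin_cases i <;> fin_cases j <;>
      simp [Jmat, Matrix.mul_apply, hqdef, h2] <;> field_simp
    · linear_combination (2 * x t) * (g t * conj (g t) * Complex.I_sq - h1)
    · linear_combination (2 * conj (c t) + 2 * x t * conj (w t)) *
        (g t * conj (g t) * Complex.I_sq - h1)
    · linear_combination (2 * c t + 2 * x t * w t) * (g t * conj (g t) * Complex.I_sq - h1)
    · linear_combination (2 * (conj (c t) + x t * conj (w t)) * w t + 2 * c t * conj (w t)) *
        (g t * conj (g t) * Complex.I_sq - h1)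
  · intro t ht
    ext i j
    exact (hΓ' t ht i j).deriv

theorem MSmoothOn.mderiv {γ : ℝ → M2} {a b : ℝ} (hγ : MSmoothOn γ (Set.Ioo a b)) :
    MSmoothOn (Mderiv γ) (Set.Ioo a b) := fun i j =>
  (hγ i j).deriv_of_isOpen isOpen_Ioo (by simp)

theorem HasDerivAt.conj_comp {f : ℝ → ℂ} {f' : ℂ} {t : ℝ} (hf : HasDerivAt f f' t) :
    HasDerivAt (fun s => conj (f s)) (conj f') t :=
  Complex.conjCLE.toContinuousLinearMap.hasFDerivAt.comp_hasDerivAt t hf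

theorem HasDerivAt.eq_of_eqOn_Ioo {E : Type*} [NormedAddCommGroup E] [NormedSpace ℝ E]
    {f g : ℝ → E} {f' g' : E} {a b t : ℝ} (hf : HasDerivAt f f' t) (hg : HasDerivAt g g' t)
    (ht : t ∈ Set.Ioo a b) (h : ∀ s ∈ Set.Ioo a b, f s = g s) : f' = g' :=
  hf.unique (hg.congr_of_eventuallyEq
    (Filter.eventually_of_mem (isOpen_Ioo.mem_nhds ht) h))

theorem conjTranspose_mderiv {γ : ℝ → M2} {a b : ℝ} (hγ : MSmoothOn γ (Set.Ioo a b))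
    (hherm : ∀ t ∈ Set.Ioo a b, (γ t)ᴴ = γ t) :
    ∀ t ∈ Set.Ioo a b, (Mderiv γ t)ᴴ = Mderiv γ t := by
  intro t ht
  ext i j
  exact (hγ.hasDerivAt ht j i).conj_comp.eq_of_eqOn_Ioo (hγ.hasDerivAt ht i j) ht
    fun s hs => congrFun (congrFun (hherm s hs) i) j

theorem hasCanonicalFrame_of_mderiv_apply_ne_zero {a b : ℝ} {γ : ℝ → M2}
    (hγsm : MSmoothOn γ (Set.Ioo a b))
    (hherm : ∀ t ∈ Set.Ioo a b, (γ t)ᴴ = γ t)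
    (hdet : ∀ t ∈ Set.Ioo a b, (γ t).det = -1)
    (hnull : ∀ t ∈ Set.Ioo a b, (Mderiv γ t).det = 0)
    (hflex : ∀ t ∈ Set.Ioo a b,
      LinearIndependent ℝ ![γ t, Mderiv γ t, Mderiv (Mderiv γ) t])
    (hne : ∀ t ∈ Set.Ioo a b, Mderiv γ t 0 0 ≠ 0) :
    HasCanonicalFrame a b γ := by
  have hγ'sm := hγsm.mderiv
  have hherm' := conjTranspose_mderiv hγsm hherm
  have hherm'' := conjTranspose_mderiv hγ'sm hherm'
  have hγ01 : ∀ t ∈ Set.Ioo a b, γ t 0 1 = conj (γ t 1 0) := fun t ht =>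
    (congrFun (congrFun (hherm t ht) 0) 1).symm
  set x : ℝ → ℝ := fun t => (γ t 0 0).re
  set A : ℝ → ℝ := fun t => (Mderiv γ t 0 0).re
  have hxγ : ∀ t ∈ Set.Ioo a b, γ t 0 0 = x t := fun t ht =>
    (Complex.conj_eq_iff_re.1 (congrFun (congrFun (hherm t ht) 0) 0)).symm
  have hAγ : ∀ t ∈ Set.Ioo a b, Mderiv γ t 0 0 = A t := fun t ht =>
    (Complex.conj_eq_iff_re.1 (congrFun (congrFun (hherm' t ht) 0) 0)).symm
  have hx : ContDiffOn ℝ ∞ x (Set.Ioo a b) :=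
    Complex.reCLM.contDiff.comp_contDiffOn (hγsm 0 0)
  have hA : ContDiffOn ℝ ∞ A (Set.Ioo a b) :=
    Complex.reCLM.contDiff.comp_contDiffOn (hγ'sm 0 0)
  have hx' : ∀ t ∈ Set.Ioo a b, HasDerivAt x (A t) t := fun t ht =>
    Complex.reCLM.hasFDerivAt.comp_hasDerivAt t (hγsm.hasDerivAt ht 0 0)
  have hA0c : ∀ t ∈ Set.Ioo a b, (A t : ℂ) ≠ 0 := fun t ht => hAγ t ht ▸ hne t ht
  have hA0 : ∀ t ∈ Set.Ioo a b, A t ≠ 0 := fun t ht => by exact_mod_cast hA0c t ht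
  set w : ℝ → ℂ := fun t => Mderiv γ t 1 0 * (A t : ℂ)⁻¹ with hwdef
  have hw : ContDiffOn ℝ ∞ w (Set.Ioo a b) := (hγ'sm 1 0).mul (hA.ofReal.inv hA0c)
  have hγ'10 : ∀ t ∈ Set.Ioo a b, Mderiv γ t 1 0 = A t * w t := by
    intro t ht
    have := hA0c t ht
    rw [hwdef]
    field_simp
  have hγ'01 : ∀ t ∈ Set.Ioo a b, Mderiv γ t 0 1 = A t * conj (w t) := by
    intro t ht
    have : conj (Mderiv γ t 1 0) = Mderiv γ t 0 1 := congrFun (congrFun (hherm' t ht) 0) 1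
    rw [← this, hγ'10 t ht, map_mul, Complex.conj_ofReal]
  have hγ'11 : ∀ t ∈ Set.Ioo a b, Mderiv γ t 1 1 = A t * (w t * conj (w t)) := by
    intro t ht
    have h := hnull t ht
    rw [Matrix.det_fin_two, hAγ t ht, hγ'10 t ht, hγ'01 t ht] at h
    refine mul_left_cancel₀ (hA0c t ht) ?_
    linear_combination h
  have hγ11 : ∀ t ∈ Set.Ioo a b, γ t 1 1 = conj (γ t 1 0) * w t + γ t 1 0 * conj (w t)
      - x t * (w t * conj (w t)) := by
    intro t ht
    have h := (((hγsm.hasDerivAt ht 0 0).mul (hγsm.hasDerivAt ht 1 1)).sub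
      ((hγsm.hasDerivAt ht 0 1).mul (hγsm.hasDerivAt ht 1 0))).eq_of_eqOn_Ioo
      (hasDerivAt_const t (-1 : ℂ)) ht
      (fun s hs => (Matrix.det_fin_two (γ s)).symm.trans (hdet s hs))
    rw [hAγ t ht, hγ'10 t ht, hγ'01 t ht, hγ'11 t ht, hγ01 t ht, hxγ t ht] at h
    refine mul_left_cancel₀ (hA0c t ht) ?_
    linear_combination h
  set c : ℝ → ℂ := fun t => γ t 1 0 - x t * w t with hcdef
  have hc : ContDiffOn ℝ ∞ c (Set.Ioo a b) := (hγsm 1 0).sub (hx.ofReal.mul hw)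
  have hcconj : ∀ t, conj (c t) = conj (γ t 1 0) - x t * conj (w t) := fun t => by
    simp [hcdef]
  have hc1 : ∀ t ∈ Set.Ioo a b, c t * conj (c t) = 1 := by
    intro t ht
    have h := hdet t ht
    rw [Matrix.det_fin_two, hxγ t ht, hγ11 t ht, hγ01 t ht] at h
    rw [hcconj, hcdef]
    linear_combination -h
  have hwd : ∀ t ∈ Set.Ioo a b, HasDerivAt w (deriv w t) t := fun t ht => hw.hasDerivAt_Ioo ht
  have horth : ∀ t ∈ Set.Ioo a b,
      conj (c t) * deriv w t + c t * conj (deriv w t) = 0 := by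
    intro t ht
    have hy := hγsm.hasDerivAt ht 1 0
    have h := (hγsm.hasDerivAt ht 1 1).eq_of_eqOn_Ioo
      (((hy.conj_comp.mul (hwd t ht)).add (hy.mul (hwd t ht).conj_comp)).sub
        ((hx' t ht).ofReal_comp.mul ((hwd t ht).mul (hwd t ht).conj_comp))) ht hγ11
    rw [hγ'11 t ht, hγ'10 t ht] at h
    simp only [map_mul, Complex.conj_ofReal, Pi.mul_apply] at h
    rw [hcconj, hcdef]
    linear_combination -h
  set h : ℝ → ℝ := fun t => (conj (c t) * deriv w t).im with hhdef
  have hh : ContDiffOn ℝ ∞ h (Set.Ioo a b) :=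
    Complex.imCLM.contDiff.comp_contDiffOn
      ((Complex.conjCLE.contDiff.comp_contDiffOn hc).mul (hw.deriv_of_isOpen isOpen_Ioo (by simp)))
  have hw1 : ∀ t ∈ Set.Ioo a b, deriv w t = I * h t * c t := by
    intro t ht
    have hIh : conj (c t) * deriv w t = I * h t := by
      have h1 := congrArg Complex.re (horth t ht)
      apply Complex.ext
      · simp at h1 ⊢
        linarith
      · simp [hhdef]
    linear_combination c t * hIh - deriv w t * hc1 t ht
  have hh0 : ∀ t ∈ Set.Ioo a b, h t ≠ 0 := by
    intro t ht h0
    have hw0 : HasDerivAt w 0 t := by simpa [hw1 t ht, h0] using hwd t ht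
    have hw0c : HasDerivAt (fun s => conj (w s)) 0 t := by simpa using hw0.conj_comp
    set B := Mderiv (Mderiv γ) t 0 0
    have hA' : HasDerivAt (fun s => Mderiv γ s 0 0) B t := hγ'sm.hasDerivAt ht 0 0
    have hB : B = (B.re : ℂ) :=
      (Complex.conj_eq_iff_re.1 (congrFun (congrFun (hherm'' t ht) 0) 0)).symm
    have hprop : ∀ i j, (A t : ℂ) * Mderiv (Mderiv γ) t i j = B * Mderiv γ t i j := by
      have key : ∀ i j (f : ℝ → ℂ), HasDerivAt f 0 t →
          (∀ s ∈ Set.Ioo a b, Mderiv γ s i j = A s * f s) →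
          (A t : ℂ) * Mderiv (Mderiv γ) t i j = B * Mderiv γ t i j := by
        intro i j f hf hfeq
        have h1 := (hγ'sm.hasDerivAt ht i j).eq_of_eqOn_Ioo (hA'.mul hf) ht
          (fun s hs => by rw [hfeq s hs]; simp [hAγ s hs])
        rw [h1, hfeq t ht]
        ring
      intro i j
      fin_cases i <;> fin_cases j
      · exact key 0 0 (fun _ => 1) (hasDerivAt_const _ _) (by simpa using hAγ)
      · exact key 0 1 _ hw0c hγ'01
      · exact key 1 0 _ hw0 hγ'10
      · exact key 1 1 _ (by convert! hw0.mul hw0c using 1; simp) hγ'11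
    have hlin := Fintype.linearIndependent_iff.1 (hflex t ht) ![0, -B.re, A t] (by
      ext i j
      have h1 := hprop i j
      rw [hB] at h1
      simp [Fin.sum_univ_three]
      linear_combination h1) 2
    exact hA0 t ht (by simpa using hlin)
  refine hasCanonicalFrame_of_coordinates hx hA hh hw hc hA0 hh0 hx'
    (fun t ht => hw1 t ht ▸ hwd t ht) (fun t ht => ?_) hc1 (fun t ht => ?_)
  · convert! (hγsm.hasDerivAt ht 1 0).sub ((hx' t ht).ofReal_comp.mul (hwd t ht)) using 1
    rw [hγ'10 t ht, hw1 t ht]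
    ring
  · have hy : c t + x t * w t = γ t 1 0 := by simp [hcdef]
    rw [hy]
    ext i j
    fin_cases i <;> fin_cases j
    · exact hxγ t ht
    · exact hγ01 t ht
    · rfl
    · exact hγ11 t ht

theorem conj_unipotent_apply (ζ : ℂ) (M : M2) :
    (!![1, ζ; 0, 1] * M * (!![1, ζ; 0, 1] : M2)ᴴ) 0 0 =
      M 0 0 + ζ * M 1 0 + conj ζ * (M 0 1 + ζ * M 1 1) := by
  simp [Matrix.mul_apply, Matrix.vecMul, dotProduct, Fin.sum_univ_two]
  ring

/-- A curve of nonzero singular Hermitian matrices is everywhere nondegenerate on some fixed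
vector `(1, conj ζ)`. -/
theorem exists_conj_unipotent_apply_ne_zero {a b : ℝ} {N : ℝ → M2}
    (hN : MSmoothOn N (Set.Ioo a b)) (hherm : ∀ t ∈ Set.Ioo a b, (N t)ᴴ = N t)
    (hdet : ∀ t ∈ Set.Ioo a b, (N t).det = 0) (hne : ∀ t ∈ Set.Ioo a b, N t ≠ 0) :
    ∃ ζ : ℂ, ∀ t ∈ Set.Ioo a b, (!![1, ζ; 0, 1] * N t * (!![1, ζ; 0, 1] : M2)ᴴ) 0 0 ≠ 0 := by
  obtain ⟨ζ, hζ⟩ := exists_notMem_image_of_differentiableAt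
    (f := fun t => -N t 0 1 * (N t 1 1)⁻¹) (S := {t | t ∈ Set.Ioo a b ∧ N t 1 1 ≠ 0})
    (fun t ht => ((hN 0 1).hasDerivAt_Ioo ht.1).differentiableAt.neg.mul
      (((hN 1 1).hasDerivAt_Ioo ht.1).differentiableAt.inv ht.2))
  refine ⟨ζ, fun t ht h0 => ?_⟩
  rw [conj_unipotent_apply] at h0
  have h01 : conj (N t 0 1) = N t 1 0 := congrFun (congrFun (hherm t ht) 1) 0
  have h11 : conj (N t 1 1) = N t 1 1 := congrFun (congrFun (hherm t ht) 1) 1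
  have hd := hdet t ht
  rw [Matrix.det_fin_two] at hd
  have hlin : N t 0 1 + ζ * N t 1 1 = 0 := by
    refine Complex.normSq_eq_zero.1 (Complex.ofReal_eq_zero.1 ?_)
    rw [← Complex.mul_conj, map_add, map_mul, h01, h11]
    linear_combination N t 1 1 * h0 - hd
  by_cases hd0 : N t 1 1 = 0
  · rw [hd0, mul_zero, add_zero] at hlin
    have h10 : N t 1 0 = 0 := by rw [← h01, hlin, map_zero]
    rw [hd0, hlin, h10] at h0
    apply hne t ht
    ext i j
    fin_cases i <;> fin_cases j
    · simpa using h0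
    · exact hlin
    · exact h10
    · exact hd0
  · refine hζ ⟨t, ⟨ht, hd0⟩, ?_⟩
    simp only
    field_simp
    linear_combination -hlin

theorem MSmoothOn.mul_mul {γ : ℝ → M2} {S : Set ℝ} (hγ : MSmoothOn γ S) (L R : M2) :
    MSmoothOn (fun t => L * γ t * R) S := by
  intro i j
  simp only [Matrix.mul_apply, Fin.sum_univ_two]
  exact (((contDiffOn_const.mul (hγ 0 0)).add (contDiffOn_const.mul (hγ 1 0))).mul
    contDiffOn_const).add (((contDiffOn_const.mul (hγ 0 1)).add
      (contDiffOn_const.mul (hγ 1 1))).mul contDiffOn_const)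

theorem mderiv_mul_mul {γ : ℝ → M2} {a b t : ℝ} (hγ : MSmoothOn γ (Set.Ioo a b)) (L R : M2)
    (ht : t ∈ Set.Ioo a b) : Mderiv (fun t => L * γ t * R) t = L * Mderiv γ t * R := by
  ext i j
  have h : ∀ i j, HasDerivAt (fun s => γ s i j) (Mderiv γ t i j) t := hγ.hasDerivAt ht
  refine HasDerivAt.deriv ?_
  simp only [Matrix.mul_apply, Fin.sum_univ_two]
  exact ((((h 0 0).const_mul _).add ((h 1 0).const_mul _)).mul_const _).add
    ((((h 0 1).const_mul _).add ((h 1 1).const_mul _)).mul_const _)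

theorem mderiv_congr {γ δ : ℝ → M2} {a b t : ℝ} (ht : t ∈ Set.Ioo a b)
    (h : ∀ s ∈ Set.Ioo a b, γ s = δ s) : Mderiv γ t = Mderiv δ t := by
  ext i j
  exact Filter.EventuallyEq.deriv_eq (Filter.eventually_of_mem (isOpen_Ioo.mem_nhds ht)
    fun s hs => congrFun (congrFun (h s hs) i) j)

theorem HasCanonicalFrame.of_conj {a b : ℝ} {γ : ℝ → M2} {L K : M2} (hK : K.det = 1)
    (hKL : K * L = 1) (h : HasCanonicalFrame a b fun t => L * γ t * Lᴴ) :
    HasCanonicalFrame a b γ := by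
  obtain ⟨ε, Γ, ω', k, hε, hΓ, hω, hω0, hk, hdet, hγ, hΓ'⟩ := h
  have hK1 : (fun t => K * Γ t) = fun t => K * Γ t * 1 := by simp
  refine ⟨ε, fun t => K * Γ t, ω', k, hε, ?_, hω, hω0, hk, ?_, ?_, ?_⟩
  · rw [hK1]
    exact hΓ.mul_mul K 1
  · intro t ht
    rw [Matrix.det_mul, hK, hdet t ht, one_mul]
  · intro t ht
    have hLK : Lᴴ * Kᴴ = 1 := by rw [← Matrix.conjTranspose_mul, hKL, Matrix.conjTranspose_one]
    calc γ t = (K * L) * γ t * (Lᴴ * Kᴴ) := by rw [hKL, hLK, one_mul, mul_one]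
      _ = K * (L * γ t * Lᴴ) * Kᴴ := by simp only [mul_assoc]
      _ = K * (Γ t * Jmat * (Γ t)ᴴ) * Kᴴ := congrArg (fun M => K * M * Kᴴ) (hγ t ht)
      _ = _ := by simp only [Matrix.conjTranspose_mul, mul_assoc]
  · intro t ht
    rw [hK1, mderiv_mul_mul hΓ K 1 ht, hΓ' t ht]
    simp [mul_assoc]

theorem linearIndependent_conj {L K : M2} (hKL : K * L = 1) {M₀ M₁ M₂ : M2}
    (h : LinearIndependent ℝ ![M₀, M₁, M₂]) :
    LinearIndependent ℝ ![L * M₀ * Lᴴ, L * M₁ * Lᴴ, L * M₂ * Lᴴ] := by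
  have hLK : Lᴴ * Kᴴ = 1 := by rw [← Matrix.conjTranspose_mul, hKL, Matrix.conjTranspose_one]
  let φ : M2 →ₗ[ℝ] M2 := (LinearMap.mulRight ℝ Lᴴ).comp (LinearMap.mulLeft ℝ L)
  have hφ : Function.LeftInverse (fun M : M2 => K * M * Kᴴ) φ := fun M =>
    calc K * (L * M * Lᴴ) * Kᴴ = (K * L) * M * (Lᴴ * Kᴴ) := by simp only [mul_assoc]
      _ = M := by rw [hKL, hLK, one_mul, mul_one]
  convert! h.map' φ (LinearMap.ker_eq_bot.2 hφ.injective) using 1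
  ext i : 1
  fin_cases i <;> rfl

theorem det_conj {L : M2} (hL : L.det = 1) (M : M2) : (L * M * Lᴴ).det = M.det := by
  simp [Matrix.det_conjTranspose, hL]

theorem conjTranspose_conj {L M : M2} (hM : Mᴴ = M) : (L * M * Lᴴ)ᴴ = L * M * Lᴴ := by
  simp [Matrix.conjTranspose_mul, hM, mul_assoc]

end

/-- Existence of the canonical frame, the canonical pseudo-arc element and the
curvature along a null curve without flex points in de Sitter 3-space. -/
theorem canonical_frame_existence (a b : ℝ) (γ : ℝ → M2)
    (hγsm : MSmoothOn γ (Set.Ioo a b))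
    (hherm : ∀ t ∈ Set.Ioo a b, (γ t)ᴴ = γ t)
    (hdet : ∀ t ∈ Set.Ioo a b, (γ t).det = -1)
    (hnull : ∀ t ∈ Set.Ioo a b, (Mderiv γ t).det = 0)
    (hflex : ∀ t ∈ Set.Ioo a b,
      LinearIndependent ℝ ![γ t, Mderiv γ t, Mderiv (Mderiv γ) t]) :
    ∃ (ε : ℝ) (Γ : ℝ → M2) (ω k : ℝ → ℝ),
      (ε = 1 ∨ ε = -1) ∧
      MSmoothOn Γ (Set.Ioo a b) ∧
      ContDiffOn ℝ (⊤ : ℕ∞) ω (Set.Ioo a b) ∧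
      (∀ t ∈ Set.Ioo a b, ω t ≠ 0) ∧
      ContDiffOn ℝ (⊤ : ℕ∞) k (Set.Ioo a b) ∧
      (∀ t ∈ Set.Ioo a b, (Γ t).det = 1) ∧
      (∀ t ∈ Set.Ioo a b, γ t = Γ t * Jmat * (Γ t)ᴴ) ∧
      (∀ t ∈ Set.Ioo a b, Mderiv Γ t = ω t • (Γ t * Hmat ε (k t))) := by
  have hne : ∀ t ∈ Set.Ioo a b, Mderiv γ t ≠ 0 := fun t ht => (hflex t ht).ne_zero 1
  obtain ⟨ζ, hζ⟩ := exists_conj_unipotent_apply_ne_zero hγsm.mderiv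
    (conjTranspose_mderiv hγsm hherm) hnull hne
  set L : M2 := !![1, ζ; 0, 1] with hLdef
  have hL : L.det = 1 := by simp [hLdef, Matrix.det_fin_two_of]
  have hK : (!![1, -ζ; 0, 1] : M2).det = 1 := by simp [Matrix.det_fin_two_of]
  have hKL : (!![1, -ζ; 0, 1] : M2) * L = 1 := by
    rw [hLdef, Matrix.one_fin_two]
    simp
  have hd : ∀ t ∈ Set.Ioo a b, Mderiv (fun s => L * γ s * Lᴴ) t = L * Mderiv γ t * Lᴴ :=
    fun t ht => mderiv_mul_mul hγsm L Lᴴ ht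
  have hd2 : ∀ t ∈ Set.Ioo a b, Mderiv (Mderiv fun s => L * γ s * Lᴴ) t =
      L * Mderiv (Mderiv γ) t * Lᴴ :=
    fun t ht => (mderiv_congr ht hd).trans (mderiv_mul_mul hγsm.mderiv L Lᴴ ht)
  refine HasCanonicalFrame.of_conj hK hKL (hasCanonicalFrame_of_mderiv_apply_ne_zero
    (hγsm.mul_mul L Lᴴ) (fun t ht => conjTranspose_conj (hherm t ht))
    (fun t ht => (det_conj hL _).trans (hdet t ht))
    (fun t ht => ?_) (fun t ht => ?_) (fun t ht => ?_))
  · rw [hd t ht, det_conj hL, hnull t ht]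
  · rw [hd t ht, hd2 t ht]
    exact linearIndependent_conj hKL (hflex t ht)
  · rw [hd t ht]
    exact hζ t ht
end
end

section
/- Let I ⊆ ℝ be an open interval, ε ∈ {1, −1}, k : I → ℝ a smooth function, and Γ : I → M₂(ℂ) a smooth map with det Γ(t) = 1 for all t, satisfying the frame equation Γ'(t) = Γ(t) · [[0, ε],[k(t) + i, 0]] for all t ∈ I. Then γ : I → M₂(ℂ) defined by γ(t) = Γ(t) · J · Γ(t)* is a null curve without flex points in de Sitter 3-space: for every t ∈ I, γ(t) is Hermitian with det γ(t) = −1, det γ'(t) = 0, and γ(t), γ'(t), γ''(t) are linearly independent over ℝ in Herm(2). -/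
open Matrix Complex

noncomputable section

/-- Derivative of a congruence `Γ C Γ*` of a constant matrix along a solution of `Γ' = Γ H`. -/
lemma Mderiv_mul_const_mul_conjTranspose {Γ : ℝ → M2} {t : ℝ} {H : M2} (C : M2)
    (hd : ∀ i j, DifferentiableAt ℝ (fun s => Γ s i j) t) (hode : Mderiv Γ t = Γ t * H) :
    Mderiv (fun s => Γ s * C * (Γ s)ᴴ) t = Γ t * (H * C + C * Hᴴ) * (Γ t)ᴴ := by
  have hΓ : ∀ i j, HasDerivAt (fun s => Γ s i j) ((Γ t * H) i j) t := fun i j => by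
    rw [← hode]
    exact (hd i j).hasDerivAt
  have hsplit : Γ t * (H * C + C * Hᴴ) * (Γ t)ᴴ
      = (Γ t * H) * C * (Γ t)ᴴ + Γ t * C * (Γ t * H)ᴴ := by
    rw [conjTranspose_mul]
    noncomm_ring
  rw [hsplit]
  ext i j
  refine HasDerivAt.deriv ?_
  have hsum : HasDerivAt (fun s => ∑ l, (∑ m, Γ s i m * C m l) * star (Γ s j l))
      (∑ l, ((∑ m, (Γ t * H) i m * C m l) * star (Γ t j l)
        + (∑ m, Γ t i m * C m l) * star ((Γ t * H) j l))) t :=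
    HasDerivAt.fun_sum fun l _ =>
      (HasDerivAt.fun_sum fun m _ => (hΓ i m).mul_const (C m l)).mul (hΓ j l).star
  rw [Finset.sum_add_distrib] at hsum
  exact hsum

/-- Congruence by an invertible matrix preserves linear independence. -/
lemma LinearIndependent.mul_mul_conjTranspose {ι : Type*} {v : ι → M2}
    (hv : LinearIndependent ℝ v) {A : M2} (hA : IsUnit A) :
    LinearIndependent ℝ fun i => A * v i * Aᴴ := by
  have hA' : IsUnit Aᴴ := hA.star
  refine hv.map_injOn ((LinearMap.mulRight ℝ Aᴴ).comp (LinearMap.mulLeft ℝ A)) ?_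
  intro x _ y _ hxy
  exact hA.mul_left_cancel (hA'.mul_right_cancel hxy)

lemma Hmat_mul_Jmat_add (ε k : ℝ) :
    Hmat ε k * Jmat + Jmat * (Hmat ε k)ᴴ = !![0, 0; 0, 2] := by
  ext i j
  fin_cases i <;> fin_cases j <;>
    simp [Hmat, Jmat, vecMul, dotProduct, Complex.ext_iff]
  norm_num

lemma Hmat_mul_diag_add (ε k : ℝ) :
    Hmat ε k * !![0, 0; 0, 2] + !![0, 0; 0, 2] * (Hmat ε k)ᴴ
      = !![0, 2 * (ε : ℂ); 2 * (ε : ℂ), 0] := by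
  ext i j
  fin_cases i <;> fin_cases j <;>
    simp [Hmat, vecMul, dotProduct, mul_comm]

lemma linearIndependent_Jmat_frame {ε : ℝ} (hε : ε ≠ 0) :
    LinearIndependent ℝ
      (![Jmat, !![0, 0; 0, 2], !![0, 2 * (ε : ℂ); 2 * (ε : ℂ), 0]] : Fin 3 → M2) := by
  rw [Fintype.linearIndependent_iff]
  intro g hg
  have h01 := congrFun (congrFun hg 0) 1
  have h11 := congrFun (congrFun hg 1) 1
  simp [Fin.sum_univ_three, Jmat, Complex.ext_iff, hε] at h01 h11
  intro i
  fin_cases i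
  exacts [h01.2, h11, h01.1]

/-- A solution of the canonical frame equation projects to a null curve
without flex points in de Sitter 3-space. -/
theorem frame_solution_gives_null_curve (a b : ℝ) (ε : ℝ) (hε : ε = 1 ∨ ε = -1)
    (k : ℝ → ℝ) (hk : ContDiffOn ℝ (⊤ : ℕ∞) k (Set.Ioo a b))
    (Γ : ℝ → M2) (hΓsm : MSmoothOn Γ (Set.Ioo a b))
    (hΓdet : ∀ t ∈ Set.Ioo a b, (Γ t).det = 1)
    (hode : ∀ t ∈ Set.Ioo a b, Mderiv Γ t = Γ t * Hmat ε (k t)) :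
    ∀ t ∈ Set.Ioo a b,
      ((fun s => Γ s * Jmat * (Γ s)ᴴ) t)ᴴ = (fun s => Γ s * Jmat * (Γ s)ᴴ) t ∧
      ((fun s => Γ s * Jmat * (Γ s)ᴴ) t).det = -1 ∧
      (Mderiv (fun s => Γ s * Jmat * (Γ s)ᴴ) t).det = 0 ∧
      LinearIndependent ℝ
        ![(fun s => Γ s * Jmat * (Γ s)ᴴ) t,
          Mderiv (fun s => Γ s * Jmat * (Γ s)ᴴ) t,
          Mderiv (Mderiv (fun s => Γ s * Jmat * (Γ s)ᴴ)) t] := by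
  intro t ht
  have hd : ∀ s ∈ Set.Ioo a b, ∀ i j, DifferentiableAt ℝ (fun s => Γ s i j) s :=
    fun s hs i j => ((hΓsm i j).differentiableOn (by simp)).differentiableAt
      (isOpen_Ioo.mem_nhds hs)
  have hγ' : ∀ s ∈ Set.Ioo a b, Mderiv (fun s => Γ s * Jmat * (Γ s)ᴴ) s
      = Γ s * !![0, 0; 0, 2] * (Γ s)ᴴ := fun s hs => by
    rw [Mderiv_mul_const_mul_conjTranspose _ (hd s hs) (hode s hs), Hmat_mul_Jmat_add]
  have hγ'' : Mderiv (Mderiv (fun s => Γ s * Jmat * (Γ s)ᴴ)) t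
      = Γ t * !![0, 2 * (ε : ℂ); 2 * (ε : ℂ), 0] * (Γ t)ᴴ := by
    rw [← Hmat_mul_diag_add ε (k t),
      ← Mderiv_mul_const_mul_conjTranspose _ (hd t ht) (hode t ht)]
    ext i j
    refine Filter.EventuallyEq.deriv_eq ?_
    filter_upwards [isOpen_Ioo.mem_nhds ht] with s hs
    rw [hγ' s hs]
  have hJ : Jmatᴴ = Jmat := by
    ext i j
    fin_cases i <;> fin_cases j <;> simp [Jmat]
  have hε0 : ε ≠ 0 := by rcases hε with rfl | rfl <;> norm_num
  have hunit : IsUnit (Γ t) := by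
    rw [Matrix.isUnit_iff_isUnit_det, hΓdet t ht]
    exact isUnit_one
  refine ⟨?_, ?_, ?_, ?_⟩
  · simp [conjTranspose_mul, hJ, mul_assoc]
  · simp [det_mul, det_conjTranspose, hΓdet t ht, Jmat, det_fin_two]
  · rw [hγ' t ht]
    simp [det_mul, det_fin_two_of]
  · rw [hγ' t ht, hγ'']
    convert (linearIndependent_Jmat_frame hε0).mul_mul_conjTranspose hunit using 1
    funext i
    fin_cases i <;> rfl
end
end

section
/- Let I ⊆ ℝ be an open interval, ε ∈ {1, −1}, m ∈ ℝ, h : I → ℝ a smooth function, and set z := ε(m/3 + i) ∈ ℂ. Define H(s) := [[0, ε],[2ε h(s) + m/3 + i, 0]] and the momentum U(s) := [[i h'(s), 2iε(h(s) − z)],[2(h(s) + 2εm/3) − iε(h''(s) − 4h(s)² + (2εm/3)h(s) + 2m²/9 − 2), −i h'(s)]]. Then the Lax equation U'(s) = U(s)·H(s) − H(s)·U(s) holds for all s ∈ I if and only if h''' = 12 h h' on I. Consequently, a map (A; h, h', h'') : I → SL(2,ℂ) × ℝ³ is an integral curve of the Euler–Lagrange system if and only if A⁻¹A' = H and U' =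 [U, H]. -/
open Matrix Complex

noncomputable section

/-- The reduced canonical frame matrix `H(h) = [[0, ε],[2εh + m/3 + i, 0]]`. -/
def Hred (ε m : ℝ) (h : ℝ → ℝ) (s : ℝ) : M2 :=
  !![0, (ε : ℂ);
     2 * (ε : ℂ) * (Complex.ofReal (h s)) + (m : ℂ) / 3 + Complex.I, 0]

/-- The momentum `U(h)` associated with the reduced curvature `h`, with
`z = ε(m/3 + i)`. -/
def Umom (ε m : ℝ) (h : ℝ → ℝ) (s : ℝ) : M2 :=
  !![Complex.I * (Complex.ofReal (deriv h s)),
     2 * Complex.I * (ε : ℂ) * ((Complex.ofReal (h s)) - (ε : ℂ) * ((m : ℂ) / 3 + Complex.I));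
     2 * ((Complex.ofReal (h s)) + 2 * (ε : ℂ) * (m : ℂ) / 3) -
       Complex.I * (ε : ℂ) * ((Complex.ofReal (deriv (deriv h) s)) - 4 * (Complex.ofReal (h s)) ^ 2 +
         (2 * (ε : ℂ) * (m : ℂ) / 3) * (Complex.ofReal (h s)) + 2 * (m : ℂ) ^ 2 / 9 - 2),
     -(Complex.I * (Complex.ofReal (deriv h s)))]

/-- The complexification of a real function has the complexified derivative. -/
theorem hasDerivAt_ofReal_deriv {f : ℝ → ℝ} {s : ℝ} (hf : DifferentiableAt ℝ f s) :
    HasDerivAt (fun t => Complex.ofReal (f t)) (Complex.ofReal (deriv f s)) s :=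
  hf.hasDerivAt.ofReal_comp

/-- The entrywise derivative of the momentum. -/
theorem Mderiv_Umom (ε m : ℝ) {h : ℝ → ℝ} {s : ℝ} (h₀ : DifferentiableAt ℝ h s)
    (h₁ : DifferentiableAt ℝ (deriv h) s) (h₂ : DifferentiableAt ℝ (deriv (deriv h)) s) :
    Mderiv (Umom ε m h) s =
      !![Complex.I * Complex.ofReal (deriv (deriv h) s),
         2 * Complex.I * (ε : ℂ) * Complex.ofReal (deriv h s);
         2 * Complex.ofReal (deriv h s) -
           Complex.I * (ε : ℂ) * (Complex.ofReal (deriv (deriv (deriv h)) s) -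
             8 * Complex.ofReal (h s) * Complex.ofReal (deriv h s) +
             (2 * (ε : ℂ) * (m : ℂ) / 3) * Complex.ofReal (deriv h s)),
         -(Complex.I * Complex.ofReal (deriv (deriv h) s))] := by
  have d₀ := hasDerivAt_ofReal_deriv h₀
  have d₁ := hasDerivAt_ofReal_deriv h₁
  have d₂ := hasDerivAt_ofReal_deriv h₂
  ext i j
  fin_cases i <;> fin_cases j
  · exact (d₁.const_mul Complex.I).deriv
  · exact ((d₀.sub_const _).const_mul _).deriv
  · refine HasDerivAt.deriv ((((d₀.add_const _).const_mul 2).sub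
      ((((((d₂.sub ((d₀.pow 2).const_mul 4)).add (d₀.const_mul _)).add_const _).sub_const
        2)).const_mul _)).congr_deriv ?_)
    simp only [Fin.mk_one, Fin.zero_eta, of_apply, cons_val]
    ring
  · exact (d₁.const_mul Complex.I).neg.deriv

/-- Only the lower left entry of the Lax equation is a condition on `h`. -/
theorem lax_equation_iff {ε : ℝ} (m : ℝ) (hε : ε = 1 ∨ ε = -1) {h : ℝ → ℝ} {s : ℝ}
    (h₀ : DifferentiableAt ℝ h s) (h₁ : DifferentiableAt ℝ (deriv h) s)
    (h₂ : DifferentiableAt ℝ (deriv (deriv h)) s) :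
    Mderiv (Umom ε m h) s = Umom ε m h s * Hred ε m h s - Hred ε m h s * Umom ε m h s ↔
      deriv (deriv (deriv h)) s = 12 * h s * deriv h s := by
  have hε2 : (ε : ℂ) ^ 2 = 1 := by rcases hε with rfl | rfl <;> norm_num
  have hε0 : (ε : ℂ) ≠ 0 := by rintro h0; simp [h0] at hε2
  have hI := Complex.I_sq
  rw [Mderiv_Umom ε m h₀ h₁ h₂]
  constructor
  · intro hL
    have h21 := congrFun (congrFun hL 1) 0
    simp [Umom, Hred] at h21
    have key : Complex.I * (ε : ℂ) * (Complex.ofReal (deriv (deriv (deriv h)) s) -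
        12 * Complex.ofReal (h s) * Complex.ofReal (deriv h s)) = 0 := by
      grind
    have := (mul_eq_zero.mp key).resolve_left (mul_ne_zero Complex.I_ne_zero hε0)
    exact_mod_cast sub_eq_zero.mp this
  · intro hE
    rw [hE]
    ext i j
    fin_cases i <;> fin_cases j <;>
      simp [Umom, Hred] <;> grind

/-- Lax formulation: the Lax equation `U' = [U, H]` holds on the interval if and
only if the reduced curvature satisfies the reduced Euler–Lagrange equation
`h''' = 12 h h'`. -/
theorem lax_formulation (a b : ℝ) (ε m : ℝ) (hε : ε = 1 ∨ ε = -1)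
    (h : ℝ → ℝ) (hsm : ContDiffOn ℝ (⊤ : ℕ∞) h (Set.Ioo a b)) :
    (∀ s ∈ Set.Ioo a b,
        Mderiv (Umom ε m h) s =
          Umom ε m h s * Hred ε m h s - Hred ε m h s * Umom ε m h s) ↔
    (∀ s ∈ Set.Ioo a b, deriv^[3] h s = 12 * h s * deriv h s) := by
  have hd (n : ℕ) : ContDiffOn ℝ (⊤ : ℕ∞) (deriv^[n] h) (Set.Ioo a b) := by
    induction n with
    | zero => exact hsm
    | succ n ih =>
      rw [Function.iterate_succ_apply']
      exact ih.deriv_of_isOpen isOpen_Ioo (by simp)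
  have hdiff (n : ℕ) {s : ℝ} (hs : s ∈ Set.Ioo a b) : DifferentiableAt ℝ (deriv^[n] h) s :=
    ((hd n).differentiableOn (by simp)).differentiableAt (isOpen_Ioo.mem_nhds hs)
  exact forall₂_congr fun s hs =>
    lax_equation_iff m hε (hdiff 0 hs) (hdiff 1 hs) (hdiff 2 hs)
end
end

section
/- (Explicit integration, Case II.) Let I ⊆ ℝ be an open interval, ε ∈ {1, −1}, m, g₂, g₃ ∈ ℝ, z := ε(m/3 + i), and let h : I → ℝ be smooth with h'' = 6h² − g₂/2 and (h')² = 4h³ − g₂h − g₃ on I. Suppose 4z³ − g₂z − g₃ = 0 (the vanishing-eigenvalue case det U(h) = 0), let c ∈ ℂ satisfy c² = −2iε, let r : I → ℂ be smooth with r(s)² = h(s) − z for all s, and let φ : I → ℂ be smooth with φ'(s) = 1/(h(s) − z). Define M(s) := c⁻¹ · [[1/r(s), −φ(s)/(2i)],[0, 1]] · [[1, 0],[−i h'(s)/r(s), −2iε r(s)]]. Then det M(s) = 1 and M'(s) = M(s) · [[0, ε],[2ε h(s) + m/3 + i, 0]] for all s ∈ I; consequently, every smooth Γ : I → M₂(ℂ)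 with Γ' = Γ·[[0, ε],[2εh + m/3 + i, 0]] and det Γ = 1 equals Γ(s) = A · M(s) for a constant matrix A with det A = 1. -/
open Matrix Complex

noncomputable section

/-- The explicit solution matrix `M(s)` of Case II (vanishing eigenvalue of the
momentum): `M = c⁻¹·[[1/r, −φ/(2i)],[0, 1]]·[[1, 0],[−ih'/r, −2iεr]]`. -/
def MsolII (ε : ℝ) (c : ℂ) (h1 : ℝ → ℝ) (r φ : ℝ → ℂ) (s : ℝ) : M2 :=
  c⁻¹ • (!![1 / r s, -(φ s) / (2 * Complex.I); 0, 1] *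
    !![1, 0;
       -(Complex.I * Complex.ofReal (h1 s)) / r s,
         -(2 * Complex.I * (ε : ℂ) * r s)])

/-- For two solutions of a linear system with trace-free coefficient matrix `H` acting on the right,
the product of one with the adjugate of the other has vanishing derivative. -/
lemma hasDerivAt_mul_adjugate_of_trace_eq_zero {X Y : ℝ → M2} {H : M2} {s : ℝ}
    (hX : ∀ i j, HasDerivAt (fun t => X t i j) ((X s * H) i j) s)
    (hY : ∀ i j, HasDerivAt (fun t => Y t i j) ((Y s * H) i j) s)
    (hH : H.trace = 0) (i j : Fin 2) :
    HasDerivAt (fun t => (X t * (Y t).adjugate) i j) 0 s := by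
  have hH' : H 1 1 = -H 0 0 := by
    rw [Matrix.trace_fin_two] at hH
    linear_combination hH
  fin_cases j
  · have key := ((hX i 0).mul (hY 1 1)).sub ((hX i 1).mul (hY 1 0))
    refine (key.congr_deriv ?_).congr_of_eventuallyEq (.of_forall fun t => ?_)
    · simp only [Matrix.mul_apply, Fin.sum_univ_two, hH']
      ring
    · simp [Matrix.mul_apply, Fin.sum_univ_two, Matrix.adjugate_fin_two]
      ring
  · have key := ((hX i 1).mul (hY 0 0)).sub ((hX i 0).mul (hY 0 1))
    refine (key.congr_deriv ?_).congr_of_eventuallyEq (.of_forall fun t => ?_)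
    · simp only [Matrix.mul_apply, Fin.sum_univ_two, hH']
      ring
    · simp [Matrix.mul_apply, Fin.sum_univ_two, Matrix.adjugate_fin_two]
      ring

/-- Two solutions of determinant one of a linear system with trace-free coefficient matrix `H` acting
on the right differ by a constant left factor of determinant one. -/
lemma exists_eq_const_mul_of_trace_eq_zero {a b : ℝ} {X Y H : ℝ → M2}
    (hX : ∀ s ∈ Set.Ioo a b, ∀ i j, HasDerivAt (fun t => X t i j) ((X s * H s) i j) s)
    (hY : ∀ s ∈ Set.Ioo a b, ∀ i j, HasDerivAt (fun t => Y t i j) ((Y s * H s) i j) s)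
    (hH : ∀ s ∈ Set.Ioo a b, (H s).trace = 0)
    (hXdet : ∀ s ∈ Set.Ioo a b, (X s).det = 1) (hYdet : ∀ s ∈ Set.Ioo a b, (Y s).det = 1) :
    ∃ A : M2, A.det = 1 ∧ ∀ s ∈ Set.Ioo a b, X s = A * Y s := by
  rcases (Set.Ioo a b).eq_empty_or_nonempty with hempty | ⟨s₀, hs₀⟩
  · exact ⟨1, by simp, by simp [hempty]⟩
  refine ⟨X s₀ * (Y s₀).adjugate, ?_, fun s hs => ?_⟩
  · simp [Matrix.det_mul, Matrix.det_adjugate, hXdet s₀ hs₀, hYdet s₀ hs₀]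
  · have hd := fun i j t ht =>
      hasDerivAt_mul_adjugate_of_trace_eq_zero (hX t ht) (hY t ht) (hH t ht) i j
    have hconst : X s₀ * (Y s₀).adjugate = X s * (Y s).adjugate := by
      ext i j
      exact isOpen_Ioo.is_const_of_deriv_eq_zero isPreconnected_Ioo
        (fun t ht => (hd i j t ht).differentiableAt.differentiableWithinAt)
        (fun t ht => (hd i j t ht).deriv) hs₀ hs
    rw [hconst, Matrix.mul_assoc, Matrix.adjugate_mul, hYdet s hs, one_smul, Matrix.mul_one]

/-- A differentiable square root `r` of `f` has derivative half that of `f` divided by `r` where it does not vanish. -/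
lemma hasDerivAt_of_sq_eq {r f : ℝ → ℂ} {f' : ℂ} {s : ℝ} (hr : DifferentiableAt ℝ r s)
    (hf : HasDerivAt f f' s) (hsq : (fun t => r t ^ 2) =ᶠ[nhds s] f) (h0 : r s ≠ 0) :
    HasDerivAt r (f' / (2 * r s)) s := by
  have huniq := (hr.hasDerivAt.pow 2).unique (hf.congr_of_eventuallyEq hsq)
  refine hr.hasDerivAt.congr_deriv ?_
  rw [eq_div_iff (by simpa using h0), ← huniq]
  push_cast
  ring

/-- The entries of `MsolII`, multiplied out. -/
lemma MsolII_eq (ε : ℝ) (c : ℂ) (h1 : ℝ → ℝ) (r φ : ℝ → ℂ) (s : ℝ) :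
    MsolII ε c h1 r φ s = !![c⁻¹ * ((r s)⁻¹ + φ s * h1 s * (r s)⁻¹ / 2), c⁻¹ * (φ s * ε * r s);
      c⁻¹ * (-I * (h1 s * (r s)⁻¹)), c⁻¹ * (-2 * I * ε * r s)] := by
  ext i j
  fin_cases i <;> fin_cases j <;> simp [MsolII] <;> field_simp
  simp

/-- Explicit integration of the canonical frame, Case II (`det U(h) = 0`). -/
theorem explicit_integration_case_II (a b : ℝ) (ε m g₂ g₃ : ℝ)
    (hε : ε = 1 ∨ ε = -1)
    (h h1 h2 : ℝ → ℝ)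
    (hd1 : ∀ s ∈ Set.Ioo a b, HasDerivAt h (h1 s) s)
    (hd2 : ∀ s ∈ Set.Ioo a b, HasDerivAt h1 (h2 s) s)
    (hW2 : ∀ s ∈ Set.Ioo a b, h2 s = 6 * (h s) ^ 2 - g₂ / 2)
    (hW1 : ∀ s ∈ Set.Ioo a b, (h1 s) ^ 2 = 4 * (h s) ^ 3 - g₂ * h s - g₃)
    (hν0 : 4 * ((ε : ℂ) * ((m : ℂ) / 3 + Complex.I)) ^ 3 -
      (g₂ : ℂ) * ((ε : ℂ) * ((m : ℂ) / 3 + Complex.I)) - (g₃ : ℂ) = 0)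
    (c : ℂ) (hc : c ^ 2 = -(2 * Complex.I * (ε : ℂ)))
    (r : ℝ → ℂ) (hrsm : ContDiffOn ℝ (⊤ : ℕ∞) r (Set.Ioo a b))
    (hr : ∀ s ∈ Set.Ioo a b,
      (r s) ^ 2 = Complex.ofReal (h s) - (ε : ℂ) * ((m : ℂ) / 3 + Complex.I))
    (φ : ℝ → ℂ) (hφsm : ContDiffOn ℝ (⊤ : ℕ∞) φ (Set.Ioo a b))
    (hφ : ∀ s ∈ Set.Ioo a b, HasDerivAt φ
      (1 / (Complex.ofReal (h s) - (ε : ℂ) * ((m : ℂ) / 3 + Complex.I))) s) :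
    (∀ s ∈ Set.Ioo a b, (MsolII ε c h1 r φ s).det = 1) ∧
    (∀ s ∈ Set.Ioo a b, ∀ i j, HasDerivAt (fun t => MsolII ε c h1 r φ t i j)
      ((MsolII ε c h1 r φ s * Hred ε m h s) i j) s) ∧
    (∀ Γ : ℝ → M2,
      (∀ s ∈ Set.Ioo a b, ∀ i j,
        HasDerivAt (fun t => Γ t i j) ((Γ s * Hred ε m h s) i j) s) →
      (∀ s ∈ Set.Ioo a b, (Γ s).det = 1) →
      ∃ A : M2, A.det = 1 ∧ ∀ s ∈ Set.Ioo a b, Γ s = A * MsolII ε c h1 r φ s) := by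
  have hε2 : (ε : ℂ) ^ 2 = 1 := by rcases hε with rfl | rfl <;> norm_num
  have hε0 : (ε : ℂ) ≠ 0 := fun h0 => by simp [h0] at hε2
  have hc0 : c ≠ 0 := fun h0 => by simp [h0, hε0] at hc
  have hr0 : ∀ s ∈ Set.Ioo a b, r s ≠ 0 := fun s hs h0 => by
    have him := congrArg Complex.im (hr s hs)
    rcases hε with rfl | rfl <;> simp [h0] at him
  have hdet : ∀ s ∈ Set.Ioo a b, (MsolII ε c h1 r φ s).det = 1 := fun s hs => by
    have := hr0 s hs
    rw [MsolII_eq, Matrix.det_fin_two_of]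
    field_simp
    linear_combination -hc
  have hder : ∀ s ∈ Set.Ioo a b, ∀ i j, HasDerivAt (fun t => MsolII ε c h1 r φ t i j)
      ((MsolII ε c h1 r φ s * Hred ε m h s) i j) s := fun s hs => by
    have hnhds := isOpen_Ioo.mem_nhds hs
    have hrs := hr0 s hs
    have hdr : HasDerivAt r (h1 s / (2 * r s)) s :=
      hasDerivAt_of_sq_eq ((hrsm.contDiffAt hnhds).differentiableAt (by simp))
        ((hd1 s hs).ofReal_comp.sub_const _) (Filter.eventually_of_mem hnhds hr) hrs
    have hdinv := hdr.fun_inv hrs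
    have hdh1 := (hd2 s hs).ofReal_comp
    have hdφ := hφ s hs
    rw [← hr s hs] at hdφ
    have hW1' : (h1 s : ℂ) ^ 2 = 4 * (h s : ℂ) ^ 3 - g₂ * h s - g₃ := by
      exact_mod_cast hW1 s hs
    have hW2' : (h2 s : ℂ) = 6 * (h s : ℂ) ^ 2 - g₂ / 2 := by
      rw [hW2 s hs]
      push_cast
      ring
    have hrs2 := hr s hs
    set z : ℂ := (ε : ℂ) * ((m : ℂ) / 3 + Complex.I) with hz
    have hHz : 2 * (ε : ℂ) * h s + (m : ℂ) / 3 + Complex.I = ε * (2 * h s + z) := by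
      rw [hz]
      linear_combination -((m : ℂ) / 3 + Complex.I) * hε2
    have hquot : HasDerivAt (fun t => (h1 t : ℂ) * (r t)⁻¹) (2 * r s * (2 * h s + z)) s := by
      refine (hdh1.mul hdinv).congr_deriv ?_
      have hhz : (h s : ℂ) = r s ^ 2 + z := by rw [hrs2]; ring
      rw [hhz] at hW1' hW2' ⊢
      field_simp
      linear_combination 2 * r s ^ 2 * hW2' - hW1' - hν0
    simp only [MsolII_eq, Hred, hHz]
    intro i j
    fin_cases i <;> fin_cases j <;>
      simp only [Matrix.mul_apply, Fin.sum_univ_two, Fin.zero_eta, Fin.mk_one, Matrix.of_apply,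
        Matrix.cons_val', Matrix.cons_val_zero, Matrix.cons_val_one, Matrix.cons_val_fin_one,
        mul_zero, zero_add, add_zero]
    · refine (((hdinv.add ((hdφ.mul hquot).div_const 2)).const_mul c⁻¹).congr_deriv ?_)
        |>.congr_of_eventuallyEq (.of_forall fun t => ?_)
      · field_simp
        linear_combination (-2) * φ s * r s ^ 4 * (2 * h s + z) * hε2
      · simp only [Pi.add_apply, Pi.mul_apply]
        ring
    · refine (((hdφ.mul_const (ε : ℂ)).mul hdr).const_mul c⁻¹).congr_deriv ?_
      field_simp
    · refine ((hquot.const_mul (-I)).const_mul c⁻¹).congr_deriv ?_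
      linear_combination c⁻¹ * 2 * I * r s * (2 * h s + z) * hε2
    · refine ((hdr.const_mul (-2 * I * ε)).const_mul c⁻¹).congr_deriv ?_
      field_simp
  exact ⟨hdet, hder, fun Γ hΓ hΓdet => exists_eq_const_mul_of_trace_eq_zero hΓ hder
    (fun s _ => by simp [Hred, Matrix.trace_fin_two]) hΓdet hdet⟩
end
end

section
/- Let a > 0 and define h : ℝ → ℝ by h(s) = 3a·tanh²(√(3a)·s) − 2a. Then h satisfies (h'(s))² = 4h(s)³ − g₂·h(s) − g₃ for all s ∈ ℝ, with invariants g₂ = 12a² and g₃ = −8a³, and consequently h'''(s) = 12·h(s)·h'(s) for all s ∈ ℝ. Moreover these invariants are degenerate: the discriminant Δ(g₂, g₃) = 27g₃² − g₂³ vanishes. -/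
noncomputable section

theorem Real.hasDerivAt_tanh (x : ℝ) : HasDerivAt Real.tanh (1 - Real.tanh x ^ 2) x := by
  have hc : Real.cosh x ≠ 0 := (Real.cosh_pos x).ne'
  have h := (Real.hasDerivAt_sinh x).div (Real.hasDerivAt_cosh x) hc
  have hfun : Real.tanh = Real.sinh / Real.cosh := funext Real.tanh_eq_sinh_div_cosh
  rw [hfun]
  refine h.congr_deriv ?_
  simp only [Pi.div_apply]
  field_simp

theorem Real.hasDerivAt_tanh_const_mul (c s : ℝ) :
    HasDerivAt (fun u => Real.tanh (c * u)) (c * (1 - Real.tanh (c * s) ^ 2)) s := by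
  refine ((Real.hasDerivAt_tanh (c * s)).comp s ((hasDerivAt_id s).const_mul c)).congr_deriv ?_
  ring

/-- The degenerate Weierstrass potential `h(s) = 3a·tanh²(√(3a)·s) − 2a`
(case `Δ = 0`, `g₃ = −8a³ < 0`): it satisfies the Weierstrass equation with
invariants `g₂ = 12a²`, `g₃ = −8a³`, hence the reduced Euler–Lagrange equation
`h''' = 12hh'`, and the discriminant `Δ = 27g₃² − g₂³` vanishes. -/
theorem degenerate_potential_tanh (a : ℝ) (ha : 0 < a) :
    (∀ s : ℝ,
      (deriv (fun u => 3 * a * Real.tanh (Real.sqrt (3 * a) * u) ^ 2 - 2 * a) s) ^ 2 =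
        4 * ((fun u => 3 * a * Real.tanh (Real.sqrt (3 * a) * u) ^ 2 - 2 * a) s) ^ 3 -
          (12 * a ^ 2) *
            ((fun u => 3 * a * Real.tanh (Real.sqrt (3 * a) * u) ^ 2 - 2 * a) s) -
          (-(8 * a ^ 3))) ∧
    (∀ s : ℝ,
      deriv^[3] (fun u => 3 * a * Real.tanh (Real.sqrt (3 * a) * u) ^ 2 - 2 * a) s =
        12 * ((fun u => 3 * a * Real.tanh (Real.sqrt (3 * a) * u) ^ 2 - 2 * a) s) *
          deriv (fun u => 3 * a * Real.tanh (Real.sqrt (3 * a) * u) ^ 2 - 2 * a) s) ∧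
    27 * (-(8 * a ^ 3)) ^ 2 - (12 * a ^ 2) ^ 3 = 0 := by
  have hc : Real.sqrt (3 * a) ^ 2 = 3 * a := Real.sq_sqrt (by positivity)
  generalize Real.sqrt (3 * a) = c at hc ⊢
  have hT := Real.hasDerivAt_tanh_const_mul c
  have h_deriv : deriv (fun u => 3 * a * Real.tanh (c * u) ^ 2 - 2 * a) =
      fun u => 6 * a * c * (Real.tanh (c * u) - Real.tanh (c * u) ^ 3) := by
    funext s
    refine (((((hT s).pow 2).const_mul (3 * a)).sub_const (2 * a)).congr_deriv ?_).deriv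
    push_cast
    ring
  have h_deriv_two : deriv (fun u => 6 * a * c * (Real.tanh (c * u) - Real.tanh (c * u) ^ 3)) =
      fun u => 18 * a ^ 2 * (1 - 4 * Real.tanh (c * u) ^ 2 + 3 * Real.tanh (c * u) ^ 4) := by
    funext s
    refine ((((hT s).sub ((hT s).pow 3)).const_mul (6 * a * c)).congr_deriv ?_).deriv
    push_cast
    linear_combination
      6 * a * (1 - 4 * Real.tanh (c * s) ^ 2 + 3 * Real.tanh (c * s) ^ 4) * hc
  have h_deriv_three (s : ℝ) : deriv (fun u => 18 * a ^ 2 *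
      (1 - 4 * Real.tanh (c * u) ^ 2 + 3 * Real.tanh (c * u) ^ 4)) s =
      72 * a ^ 2 * c * (3 * Real.tanh (c * s) ^ 2 - 2) *
        (Real.tanh (c * s) - Real.tanh (c * s) ^ 3) := by
    refine ((((((hT s).pow 2).const_mul 4).const_sub 1).add
      (((hT s).pow 4).const_mul 3)).const_mul (18 * a ^ 2) |>.congr_deriv ?_).deriv
    push_cast
    ring
  refine ⟨fun s => ?_, fun s => ?_, by ring⟩
  · rw [h_deriv]
    linear_combination
      36 * a ^ 2 * (Real.tanh (c * s) - Real.tanh (c * s) ^ 3) ^ 2 * hc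
  · simp only [Function.iterate_succ, Function.iterate_zero, Function.comp_apply, id]
    rw [h_deriv, h_deriv_two, h_deriv_three]
    ring
end
end

section
/- Let a < 0 and define h on the open interval I = (−π/√(−12a), π/√(−12a)) by h(s) = −3a·tan²(√(−3a)·s) − 2a. Then h satisfies (h'(s))² = 4h(s)³ − g₂·h(s) − g₃ for all s ∈ I, with invariants g₂ = 12a² and g₃ = −8a³ > 0, and consequently h'''(s) = 12·h(s)·h'(s) for all s ∈ I. Moreover these invariants are degenerate: the discriminant Δ(g₂, g₃) = 27g₃² − g₂³ vanishes. -/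
noncomputable section

/-- The derivative of `u ↦ tan (c u)`, written as a polynomial in `tan (c u)`. -/
theorem hasDerivAt_tan_const_mul {c u : ℝ} (h : Real.cos (c * u) ≠ 0) :
    HasDerivAt (fun v => Real.tan (c * v)) (c * (1 + Real.tan (c * u) ^ 2)) u := by
  have hlin : HasDerivAt (fun v : ℝ => c * v) c u := by
    simpa using (hasDerivAt_id u).const_mul c
  have hsec : 1 / Real.cos (c * u) ^ 2 = 1 + Real.tan (c * u) ^ 2 := by
    rw [← Real.inv_one_add_tan_sq h, one_div, inv_inv]
  have htan := (Real.hasDerivAt_tan h).comp u hlin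
  rw [hsec, mul_comm] at htan
  exact htan

/-- The cosine of `√(-3a) s` does not vanish on the interval `|s| < π / √(-12a)`. -/
theorem cos_sqrt_mul_ne_zero {a s : ℝ} (ha : a < 0)
    (hs : s ∈ Set.Ioo (-(Real.pi / Real.sqrt (-12 * a))) (Real.pi / Real.sqrt (-12 * a))) :
    Real.cos (Real.sqrt (-3 * a) * s) ≠ 0 := by
  have hc : 0 < Real.sqrt (-3 * a) := Real.sqrt_pos.mpr (by linarith)
  have hsqrt : Real.sqrt (-12 * a) = 2 * Real.sqrt (-3 * a) := by
    rw [show -12 * a = 2 ^ 2 * (-3 * a) by ring, Real.sqrt_mul (by norm_num),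
      Real.sqrt_sq (by norm_num)]
  have hend : Real.sqrt (-3 * a) * (Real.pi / Real.sqrt (-12 * a)) = Real.pi / 2 := by
    rw [hsqrt]
    generalize Real.sqrt (-3 * a) = c at hc
    field_simp
  have hlower := mul_lt_mul_of_pos_left hs.1 hc
  have hupper := mul_lt_mul_of_pos_left hs.2 hc
  rw [mul_neg, hend] at hlower
  rw [hend] at hupper
  exact ne_of_gt (Real.cos_pos_of_mem_Ioo ⟨hlower, hupper⟩)

/-- The degenerate Weierstrass potential `h(s) = −3a·tan²(√(−3a)·s) − 2a` on
`(−π/√(−12a), π/√(−12a))` (case `Δ = 0`, `g₃ = −8a³ > 0`): it satisfies the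
Weierstrass equation with invariants `g₂ = 12a²`, `g₃ = −8a³ > 0`, hence the
reduced Euler–Lagrange equation `h''' = 12hh'`, and the discriminant
`Δ = 27g₃² − g₂³` vanishes. -/
theorem degenerate_potential_tan (a : ℝ) (ha : a < 0) :
    (∀ s ∈ Set.Ioo (-(Real.pi / Real.sqrt (-12 * a))) (Real.pi / Real.sqrt (-12 * a)),
      (deriv (fun u => -3 * a * Real.tan (Real.sqrt (-3 * a) * u) ^ 2 - 2 * a) s) ^ 2 =
        4 * ((fun u => -3 * a * Real.tan (Real.sqrt (-3 * a) * u) ^ 2 - 2 * a) s) ^ 3 -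
          (12 * a ^ 2) *
            ((fun u => -3 * a * Real.tan (Real.sqrt (-3 * a) * u) ^ 2 - 2 * a) s) -
          (-(8 * a ^ 3))) ∧
    (0 : ℝ) < -(8 * a ^ 3) ∧
    (∀ s ∈ Set.Ioo (-(Real.pi / Real.sqrt (-12 * a))) (Real.pi / Real.sqrt (-12 * a)),
      deriv^[3] (fun u => -3 * a * Real.tan (Real.sqrt (-3 * a) * u) ^ 2 - 2 * a) s =
        12 * ((fun u => -3 * a * Real.tan (Real.sqrt (-3 * a) * u) ^ 2 - 2 * a) s) *
          deriv (fun u => -3 * a * Real.tan (Real.sqrt (-3 * a) * u) ^ 2 - 2 * a) s) ∧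
    27 * (-(8 * a ^ 3)) ^ 2 - (12 * a ^ 2) ^ 3 = 0 := by
  have hsq : Real.sqrt (-3 * a) ^ 2 = -3 * a := Real.sq_sqrt (by linarith)
  set c := Real.sqrt (-3 * a)
  set I := Set.Ioo (-(Real.pi / Real.sqrt (-12 * a))) (Real.pi / Real.sqrt (-12 * a))
  set h : ℝ → ℝ := fun u => -3 * a * Real.tan (c * u) ^ 2 - 2 * a with hh
  have htan : ∀ s ∈ I,
      HasDerivAt (fun v => Real.tan (c * v)) (c * (1 + Real.tan (c * s) ^ 2)) s :=
    fun s hs => hasDerivAt_tan_const_mul (cos_sqrt_mul_ne_zero ha hs)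
  have hderiv : ∀ s ∈ I, HasDerivAt h
      (-6 * a * c * (Real.tan (c * s) + Real.tan (c * s) ^ 3)) s := by
    intro s hs
    refine ((((htan s hs).fun_pow 2).const_mul (-3 * a)).sub_const (2 * a)).congr_deriv ?_
    push_cast
    ring
  have hderiv_eqOn : Set.EqOn (deriv h)
      (fun u => -6 * a * c * (Real.tan (c * u) + Real.tan (c * u) ^ 3)) I :=
    fun s hs => (hderiv s hs).deriv
  have hderiv₂ : Set.EqOn (deriv (deriv h)) (fun u => 6 * h u ^ 2 - 6 * a ^ 2) I := by
    intro s hs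
    rw [hderiv_eqOn.deriv isOpen_Ioo hs,
      (((htan s hs).fun_add ((htan s hs).fun_pow 3)).const_mul (-6 * a * c)).deriv]
    simp only [hh]
    push_cast
    linear_combination
      -6 * a * (1 + Real.tan (c * s) ^ 2) * (1 + 3 * Real.tan (c * s) ^ 2) * hsq
  refine ⟨fun s hs => ?_, ?_, fun s hs => ?_, by ring⟩
  · rw [hderiv_eqOn hs]
    simp only [hh]
    linear_combination
      36 * a ^ 2 * (Real.tan (c * s) + Real.tan (c * s) ^ 3) ^ 2 * hsq
  · have := Odd.pow_neg (by decide : Odd 3) ha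
    linarith
  · change deriv (deriv (deriv h)) s = 12 * h s * deriv h s
    rw [hderiv₂.deriv isOpen_Ioo hs, (hderiv s hs).deriv,
      ((((hderiv s hs).fun_pow 2).const_mul 6).sub_const (6 * a ^ 2)).deriv]
    push_cast
    ring
end
end
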